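/- Let m ≥ 1, a ≥ 1, C_0 > 0, Λ ≥ 0 be real numbers, let n ≥ 1 be a natural number, let x_1, …, x_n be nonnegative reals, and let λ, h_1, …, h_n be reals with 0 ≤ λ ≤ Λ·n and h_i ≥ C_0/(1+x_i) for every i. Set S := ∑_{j=1}^n (1+x_j)^m and S' := ∑_{j=1}^n (1+x_j)^{m−1} (real powers). Then λ·((1+S)^a − S^a) − ∑_{i=1}^n h_i·(S^a − (S − (1+x_i)^m)^a) + a·m·S'·S^{a−1} ≤ −(C_0 − Λ·a·2^a − m·a) · S' · S^{a−1}. -/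

import Mathlib

/-- Upper bound on the unit increment of a real power `a ≥ 1`, from the Bernoulli inequality. -/
theorem Real.one_add_rpow_sub_rpow_le {a s : ℝ} (ha : 1 ≤ a) (hs : 0 ≤ s) :
    (1 + s) ^ a - s ^ a ≤ a * (1 + s) ^ (a - 1) := by
  have hs1 : 0 < 1 + s := by linarith
  have ht : -1 ≤ -(1 + s)⁻¹ := neg_le_neg (inv_le_one_of_one_le₀ (by linarith))
  have hB := one_add_mul_self_le_rpow_one_add ht ha
  have hst : s = (1 + s) * (1 + -(1 + s)⁻¹) := by field_simp; ring
  have hsa : s ^ a = (1 + s) ^ a * (1 + -(1 + s)⁻¹) ^ a := by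
    conv_lhs => rw [hst]
    exact Real.mul_rpow hs1.le (by linarith)
  have hmul := mul_le_mul_of_nonneg_left hB (Real.rpow_nonneg hs1.le a)
  have hdiv : (1 + s) ^ (a - 1) = (1 + s) ^ a * (1 + s)⁻¹ := by
    rw [Real.rpow_sub_one hs1.ne', div_eq_mul_inv]
  rw [hsa, hdiv]
  linarith

/-- Lower bound on the decrement of a real power `a ≥ 1`. -/
theorem Real.mul_rpow_sub_one_le_rpow_sub {a s y : ℝ} (ha : 1 ≤ a) (hy : 0 ≤ y) (hys : y ≤ s)
    (hs : 0 < s) : y * s ^ (a - 1) ≤ s ^ a - (s - y) ^ a := by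
  have hle : (s - y) ^ (a - 1) ≤ s ^ (a - 1) :=
    Real.rpow_le_rpow (by linarith) (by linarith) (by linarith)
  have hpow : ∀ {t : ℝ}, 0 ≤ t → t ^ a = t * t ^ (a - 1) := fun {t} ht => by
    rw [← Real.rpow_one_add' ht (by linarith), add_sub_cancel]
  have hmul := mul_le_mul_of_nonneg_left hle (sub_nonneg.2 hys)
  rw [hpow hs.le, hpow (sub_nonneg.2 hys)]
  linarith

/-- Combined drift estimate: with `S = ∑ j (1+x_j)^m` and `S' = ∑ j (1+x_j)^{m−1}`
(real powers), arrival intensity `0 ≤ λ ≤ Λ·n` and service intensities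
`h_i ≥ C₀/(1+x_i)`, the generator terms satisfy
`λ((1+S)^a − S^a) − ∑ i h_i (S^a − (S−(1+x_i)^m)^a) + a m S' S^{a−1}
  ≤ −(C₀ − Λ a 2^a − m a) S' S^{a−1}`. -/
theorem combined_drift_estimate (m a C₀ Λ : ℝ) (hm : 1 ≤ m) (ha : 1 ≤ a)
    (hC₀ : 0 < C₀) (hΛ : 0 ≤ Λ) (n : ℕ) (hn : 1 ≤ n)
    (x : Fin n → ℝ) (hx : ∀ j, 0 ≤ x j)
    (lam : ℝ) (h : Fin n → ℝ)
    (hlam0 : 0 ≤ lam) (hlam : lam ≤ Λ * n)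
    (hh : ∀ i, C₀ / (1 + x i) ≤ h i) :
    lam * ((1 + ∑ j, (1 + x j) ^ m) ^ a - (∑ j, (1 + x j) ^ m) ^ a)
      - (∑ i, h i * ((∑ j, (1 + x j) ^ m) ^ a
          - ((∑ j, (1 + x j) ^ m) - (1 + x i) ^ m) ^ a))
      + a * m * (∑ j, (1 + x j) ^ (m - 1)) * (∑ j, (1 + x j) ^ m) ^ (a - 1)
    ≤ -(C₀ - Λ * a * 2 ^ a - m * a)
        * (∑ j, (1 + x j) ^ (m - 1)) * (∑ j, (1 + x j) ^ m) ^ (a - 1) := by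
  have hx1 : ∀ j, 1 ≤ 1 + x j := fun j => by linarith [hx j]
  have card_le : ∀ p : ℝ, 0 ≤ p → (n : ℝ) ≤ ∑ j, (1 + x j) ^ p := fun p hp => by
    simpa using Finset.sum_le_sum
      (fun j (_ : j ∈ Finset.univ) => Real.one_le_rpow (hx1 j) hp)
  have hn1 : (1 : ℝ) ≤ n := by exact_mod_cast hn
  have hS := card_le m (by linarith)
  have hS' := card_le (m - 1) (by linarith)
  have hy : ∀ i, 0 ≤ (1 + x i) ^ m := fun i => Real.rpow_nonneg (by linarith [hx i]) m
  have hyS : ∀ i, (1 + x i) ^ m ≤ ∑ j, (1 + x j) ^ m := fun i =>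
    Finset.single_le_sum (fun j _ => hy j) (Finset.mem_univ i)
  have service : C₀ * (∑ j, (1 + x j) ^ (m - 1)) * (∑ j, (1 + x j) ^ m) ^ (a - 1)
      ≤ ∑ i, h i * ((∑ j, (1 + x j) ^ m) ^ a
          - ((∑ j, (1 + x j) ^ m) - (1 + x i) ^ m) ^ a) := by
    generalize (∑ j, (1 + x j) ^ m) = S at *
    rw [Finset.mul_sum, Finset.sum_mul]
    refine Finset.sum_le_sum fun i _ => ?_
    have hpos : 0 < 1 + x i := by linarith [hx i]
    have hdrop := Real.mul_rpow_sub_one_le_rpow_sub ha (hy i) (hyS i) (by linarith)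
    have hdrop0 : 0 ≤ (1 + x i) ^ m * S ^ (a - 1) :=
      mul_nonneg (hy i) (Real.rpow_nonneg (by linarith) _)
    calc C₀ * (1 + x i) ^ (m - 1) * S ^ (a - 1)
        = C₀ / (1 + x i) * ((1 + x i) ^ m * S ^ (a - 1)) := by
          rw [Real.rpow_sub_one hpos.ne']; ring
      _ ≤ h i * (S ^ a - (S - (1 + x i) ^ m) ^ a) :=
          mul_le_mul (hh i) hdrop hdrop0 ((div_pos hC₀ hpos).le.trans (hh i))
  generalize (∑ j, (1 + x j) ^ m) = S at *
  generalize (∑ j, (1 + x j) ^ (m - 1)) = S' at *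
  have hpow : 0 ≤ S ^ (a - 1) := Real.rpow_nonneg (by linarith) _
  have jump : (1 + S) ^ a - S ^ a ≤ a * 2 ^ a * S ^ (a - 1) :=
    calc (1 + S) ^ a - S ^ a ≤ a * (1 + S) ^ (a - 1) :=
          Real.one_add_rpow_sub_rpow_le ha (by linarith)
      _ ≤ a * (2 * S) ^ (a - 1) := by
          gcongr
          all_goals linarith
      _ = a * (2 ^ (a - 1) * S ^ (a - 1)) := by
          rw [Real.mul_rpow zero_le_two (by linarith)]
      _ ≤ a * (2 ^ a * S ^ (a - 1)) := by
          gcongr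
          all_goals linarith
      _ = a * 2 ^ a * S ^ (a - 1) := by ring
  have arrival : lam * ((1 + S) ^ a - S ^ a) ≤ Λ * S' * (a * 2 ^ a * S ^ (a - 1)) := by
    have hlamS' : lam ≤ Λ * S' := hlam.trans (mul_le_mul_of_nonneg_left hS' hΛ)
    exact (mul_le_mul_of_nonneg_left jump hlam0).trans
      (mul_le_mul_of_nonneg_right hlamS' (by positivity))
  linarith
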